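/- Let G be a finite chordal bipartite graph with bipartition (U, W) and at least one edge; that is, G is bipartite and every cycle of G of length at least six has a chord (an edge of G joining two non-consecutive vertices of the cycle). Then both U and W contain a rare vertex. -/

import Mathlib

/-- A set of vertices is stable (independent): no two of its vertices are adjacent. -/
def IsStable {V : Type*} (G : SimpleGraph V) (S : Set V) : Prop :=
  ∀ ⦃u⦄, u ∈ S → ∀ ⦃v⦄, v ∈ S → ¬G.Adj u v

/-- A maximal stable set: stable, and every vertex outside has a neighbour inside. -/
def IsMaxStable {V : Type*} (G : SimpleGraph V) (S : Set V) : Prop :=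
  IsStable G S ∧ ∀ v ∉ S, ∃ u ∈ S, G.Adj v u

/-- The set of all maximal stable sets of `G`. -/
def MSS {V : Type*} (G : SimpleGraph V) : Set (Set V) := {S | IsMaxStable G S}

/-- The number of maximal stable sets of `G` containing all vertices of `X`. -/
noncomputable def mssOn {V : Type*} (G : SimpleGraph V) (X : Set V) : ℕ :=
  {S | S ∈ MSS G ∧ X ⊆ S}.ncard

/-- A vertex is rare if it lies in at most half of the maximal stable sets. -/
def Rare {V : Type*} (G : SimpleGraph V) (v : V) : Prop :=
  2 * mssOn G {v} ≤ (MSS G).ncard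

/-- The neighbourhood of a set of vertices: all vertices with a neighbour in `A`. -/
def NSet {V : Type*} (G : SimpleGraph V) (A : Set V) : Set V := {v | ∃ u ∈ A, G.Adj v u}

/-- A bipartition of `G`: a partition of the vertex set into two stable sets. -/
def IsBipartition {V : Type*} (G : SimpleGraph V) (U W : Set V) : Prop :=
  U ∪ W = Set.univ ∧ Disjoint U W ∧ IsStable G U ∧ IsStable G W

section

variable {V : Type*} {G : SimpleGraph V}

theorem IsBipartition.symm {U W : Set V} (h : IsBipartition G U W) : IsBipartition G W U :=
  ⟨by rw [Set.union_comm]; exact h.1, h.2.1.symm, h.2.2.2, h.2.2.1⟩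

theorem IsBipartition.mem_left_or_right {U W : Set V} (h : IsBipartition G U W) (v : V) :
    v ∈ U ∨ v ∈ W := by
  have : v ∈ U ∪ W := h.1 ▸ Set.mem_univ v
  exact this

theorem IsBipartition.notMem_right {U W : Set V} (h : IsBipartition G U W) {v : V}
    (hv : v ∈ U) : v ∉ W :=
  fun hw => Set.disjoint_left.mp h.2.1 hv hw

theorem IsBipartition.mem_right_of_adj {U W : Set V} (h : IsBipartition G U W) {u v : V}
    (hu : u ∈ U) (huv : G.Adj u v) : v ∈ W :=
  (h.mem_left_or_right v).resolve_left fun hv => h.2.2.1 hu hv huv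

/-- Two maximal stable sets of a bipartite graph with the same trace on one class satisfy an
inclusion (hence are equal, by symmetry). -/
theorem IsMaxStable.subset_of_inter_eq {U W : Set V} (hb : IsBipartition G U W) {S T : Set V}
    (hS : IsMaxStable G S) (hT : IsMaxStable G T) (h : S ∩ W = T ∩ W) : S ⊆ T := by
  intro v hv
  rcases hb.mem_left_or_right v with hU | hW
  · by_contra hvT
    obtain ⟨w, hwT, hvw⟩ := hT.2 v hvT
    have hw : w ∈ S ∩ W := h ▸ ⟨hwT, hb.mem_right_of_adj hU hvw⟩
    exact hS.1 hv hw.1 hvw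
  · have : v ∈ T ∩ W := h ▸ ⟨hv, hW⟩
    exact this.1

/-- The maximal stable set whose trace on `W` is the trace of `S` minus the neighbours of `x`. -/
def removeNeighbors (G : SimpleGraph V) (U W : Set V) (x : V) (S : Set V) : Set V :=
  {v | (v ∈ W ∧ v ∈ S ∧ ¬G.Adj x v) ∨ (v ∈ U ∧ ∀ w ∈ W, w ∈ S → ¬G.Adj x w → ¬G.Adj v w)}

theorem isMaxStable_removeNeighbors {U W : Set V} (hb : IsBipartition G U W) {x : V}
    (hx : x ∈ U) {S : Set V} (hS : IsMaxStable G S) :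
    IsMaxStable G (removeNeighbors G U W x S) := by
  constructor
  · rintro u (⟨huW, huS, hxu⟩ | ⟨huU, hu⟩) v (⟨hvW, hvS, hxv⟩ | ⟨hvU, hv⟩) huv
    · exact hb.2.2.2 huW hvW huv
    · exact hv u huW huS hxu huv.symm
    · exact hu v hvW hvS hxv huv
    · exact hb.2.2.1 huU hvU huv
  · intro v hv
    simp only [removeNeighbors, Set.mem_ofPred_eq, not_or, not_and, not_forall, not_not] at hv
    rcases hb.mem_left_or_right v with hU | hW
    · obtain ⟨w, hwW, hwS, hxw, hvw⟩ := hv.2 hU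
      exact ⟨w, Or.inl ⟨hwW, hwS, hxw⟩, hvw⟩
    · by_cases hvS : v ∈ S
      · exact ⟨x, Or.inr ⟨hx, fun w _ _ h => h⟩, (hv.1 hW hvS).symm⟩
      · obtain ⟨u, huS, hvu⟩ := hS.2 v hvS
        exact ⟨u, Or.inr ⟨hb.symm.mem_right_of_adj hW hvu,
          fun w _ hwS _ huw => hS.1 huS hwS huw⟩, hvu⟩

/-- If among the neighbours of `x` the vertex `y` has the largest neighbourhood, then `y` is
rare. -/
theorem rare_of_maximum_neighbor [Finite V] {U W : Set V} (hb : IsBipartition G U W) {x y : V}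
    (hx : x ∈ U) (hxy : G.Adj x y)
    (hmax : ∀ y', G.Adj x y' → ∀ u, G.Adj y' u → G.Adj y u) : Rare G y := by
  have hy : y ∈ W := hb.mem_right_of_adj hx hxy
  have hsub : ∀ S, IsMaxStable G S → y ∈ S → ∀ w, G.Adj x w → w ∈ S := by
    intro S hS hyS w hxw
    by_contra hw
    obtain ⟨u, huS, hwu⟩ := hS.2 w hw
    exact hS.1 hyS huS (hmax w hxw u hwu)
  have hsplit : MSS G = {S | S ∈ MSS G ∧ {y} ⊆ S} ∪ {S | S ∈ MSS G ∧ y ∉ S} := by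
    ext S
    simp only [Set.singleton_subset_iff, Set.mem_union, Set.mem_ofPred_eq]
    tauto
  have hdisj : Disjoint {S | S ∈ MSS G ∧ {y} ⊆ S} {S | S ∈ MSS G ∧ y ∉ S} := by
    rw [Set.disjoint_left]
    rintro S ⟨-, h⟩ ⟨-, h'⟩
    exact h' (h rfl)
  have hle : {S | S ∈ MSS G ∧ {y} ⊆ S}.ncard ≤ {S | S ∈ MSS G ∧ y ∉ S}.ncard := by
    refine Set.ncard_le_ncard_of_injOn (removeNeighbors G U W x) ?_ ?_ (Set.toFinite _)
    · rintro S ⟨hS, -⟩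
      refine ⟨isMaxStable_removeNeighbors hb hx hS, ?_⟩
      rintro (⟨-, -, h⟩ | ⟨h, -⟩)
      · exact h hxy
      · exact hb.notMem_right h hy
    · rintro S ⟨hS, hyS⟩ T ⟨hT, hyT⟩ hST
      rw [Set.singleton_subset_iff] at hyS hyT
      have hmem : ∀ R : Set V, ∀ w ∈ W, ¬G.Adj x w → (w ∈ removeNeighbors G U W x R ↔ w ∈ R) := by
        intro R w hw hxw
        constructor
        · rintro (h | h)
          · exact h.2.1
          · exact absurd hw (hb.notMem_right h.1)
        · exact fun h => Or.inl ⟨hw, h, hxw⟩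
      have htrace : S ∩ W = T ∩ W := by
        ext w
        refine and_congr_left fun hw => ?_
        by_cases hxw : G.Adj x w
        · exact iff_of_true (hsub S hS hyS w hxw) (hsub T hT hyT w hxw)
        · rw [← hmem S w hw hxw, hST, hmem T w hw hxw]
      exact (hS.subset_of_inter_eq hb hT htrace).antisymm
        (hT.subset_of_inter_eq hb hS htrace.symm)
  have hcard : (MSS G).ncard =
      {S | S ∈ MSS G ∧ {y} ⊆ S}.ncard + {S | S ∈ MSS G ∧ y ∉ S}.ncard := by
    rw [← Set.ncard_union_eq hdisj (Set.toFinite _) (Set.toFinite _), ← hsplit]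
  rw [Rare, mssOn]
  omega

/-- Every cycle of length at least six has a chord. -/
def IsSixChordal (G : SimpleGraph V) : Prop :=
  ∀ (v : V) (c : G.Walk v v), c.IsCycle → 6 ≤ c.length →
    ∃ u w, u ∈ c.support ∧ w ∈ c.support ∧ G.Adj u w ∧ s(u, w) ∉ c.edges

theorem IsSixChordal.exists_oriented_chord {U W : Set V} (hb : IsBipartition G U W)
    (hc : IsSixChordal G) {v : V} (c : G.Walk v v) (hcyc : c.IsCycle) (hlen : 6 ≤ c.length) :
    ∃ u w, u ∈ U ∧ w ∈ W ∧ u ∈ c.support ∧ w ∈ c.support ∧ G.Adj u w ∧ s(u, w) ∉ c.edges := by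
  obtain ⟨u, w, hu, hw, huw, hnot⟩ := hc v c hcyc hlen
  rcases hb.mem_left_or_right u with hU | hW
  · exact ⟨u, w, hU, hb.mem_right_of_adj hU huw, hu, hw, huw, hnot⟩
  · exact ⟨w, u, hb.symm.mem_right_of_adj hW huw, hW, hw, hu, huw.symm, by rwa [Sym2.eq_swap]⟩

/-- In a hexagon of a six-chordal bipartite graph, some long diagonal is present. -/
theorem IsSixChordal.hexagon {U W : Set V} (hb : IsBipartition G U W) (hc : IsSixChordal G)
    {a b c x y z : V} (ha : a ∈ U) (hbU : b ∈ U) (hcU : c ∈ U)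
    (hax : G.Adj a x) (hbx : G.Adj b x) (hby : G.Adj b y) (hcy : G.Adj c y)
    (hcz : G.Adj c z) (haz : G.Adj a z) : G.Adj a y ∨ G.Adj b z ∨ G.Adj c x := by
  by_contra! h
  obtain ⟨hay, hbz, hcx⟩ := h
  have hx := hb.mem_right_of_adj ha hax
  have hy := hb.mem_right_of_adj hbU hby
  have hz := hb.mem_right_of_adj hcU hcz
  have hne : ∀ u ∈ U, ∀ w ∈ W, u ≠ w := fun u hu w hw huw => hb.notMem_right hu (huw ▸ hw)
  have hab : a ≠ b := by rintro rfl; exact hay hby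
  have hac : a ≠ c := by rintro rfl; exact hay hcy
  have hbc : b ≠ c := by rintro rfl; exact hbz hcz
  have hxy : x ≠ y := by rintro rfl; exact hay hax
  have hxz : x ≠ z := by rintro rfl; exact hbz hbx
  have hyz : y ≠ z := by rintro rfl; exact hay haz
  let p : G.Walk a a := .cons hax (.cons hbx.symm (.cons hby (.cons hcy.symm (.cons hcz
    (.cons haz.symm .nil)))))
  have hp : p.IsCycle := by
    have := hne a ha x hx
    have := hne a ha y hy
    have := hne a ha z hz
    have := hne b hbU x hx
    have := hne b hbU y hy
    have := hne b hbU z hz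
    have := hne c hcU x hx
    have := hne c hcU y hy
    have := hne c hcU z hz
    rw [SimpleGraph.Walk.cons_isCycle_iff]
    simp [SimpleGraph.Walk.cons_isPath_iff]
    grind
  obtain ⟨u, w, huU, hwW, hu, hw, huw, hnot⟩ := hc.exists_oriented_chord hb p hp (by simp [p])
  have hu' : u = a ∨ u = b ∨ u = c := by
    simp only [p, SimpleGraph.Walk.support_cons, SimpleGraph.Walk.support_nil,
      List.mem_cons, List.not_mem_nil, or_false] at hu
    have := hne u huU x hx
    have := hne u huU y hy
    have := hne u huU z hz
    tauto
  have hw' : w = x ∨ w = y ∨ w = z := by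
    simp only [p, SimpleGraph.Walk.support_cons, SimpleGraph.Walk.support_nil,
      List.mem_cons, List.not_mem_nil, or_false] at hw
    have := (hne a ha w hwW).symm
    have := (hne b hbU w hwW).symm
    have := (hne c hcU w hwW).symm
    tauto
  rcases hu' with rfl | rfl | rfl <;> rcases hw' with rfl | rfl | rfl <;>
    first | contradiction | (simp [p] at hnot)

/-- A chord of a path yields a strictly shorter walk between its ends. -/
theorem SimpleGraph.Walk.exists_length_lt_of_chord {H : SimpleGraph V} {a b u w : V}
    (p : H.Walk a b) (hu : u ∈ p.support) (hw : w ∈ p.support) (huw : H.Adj u w)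
    (hnot : s(u, w) ∉ p.edges) : ∃ q : H.Walk a b, q.length < p.length := by
  rw [SimpleGraph.Walk.mem_support_iff_exists_getVert] at hu hw
  obtain ⟨i, rfl, hi⟩ := hu
  obtain ⟨j, rfl, hj⟩ := hw
  wlog hij : i ≤ j generalizing i j
  · exact this j hj i hi huw.symm (by rwa [Sym2.eq_swap]) (by omega)
  have hne : i ≠ j := by rintro rfl; exact H.irrefl huw
  have hsucc : j ≠ i + 1 := by
    rintro rfl
    apply hnot
    rw [← SimpleGraph.Walk.mem_edges_toSubgraph]
    exact p.toSubgraph_adj_getVert (by omega)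
  refine ⟨(p.take i).append (.cons huw (p.drop j)), ?_⟩
  simp [SimpleGraph.Walk.take_length, SimpleGraph.Walk.drop_length]
  omega

/-- The subgraph of edges with both ends in `X`, on the same vertex type. -/
def edgesWithin (G : SimpleGraph V) (X : Set V) : SimpleGraph V where
  Adj u v := G.Adj u v ∧ u ∈ X ∧ v ∈ X
  symm := ⟨fun _ _ h => ⟨h.1.symm, h.2.2, h.2.1⟩⟩
  loopless := ⟨fun _ h => G.irrefl h.1⟩

theorem edgesWithin_le (X : Set V) : edgesWithin G X ≤ G := fun _ _ h => h.1

theorem mem_of_reachable_edgesWithin {X : Set V} {a b : V} (ha : a ∈ X)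
    (h : (edgesWithin G X).Reachable a b) : b ∈ X := by
  obtain ⟨p⟩ := h
  induction p with
  | nil => exact ha
  | cons h _ ih => exact ih h.2.2

/-- If two neighbours `t`, `s` of `y₀` are joined by a path whose interior lies in a set `X`
avoiding the neighbourhood of `y₀`, then `t` and `s` have a common neighbour in the same
component of `X`. -/
theorem IsSixChordal.exists_common_neighbor {U W : Set V} (hb : IsBipartition G U W)
    (hc : IsSixChordal G) {X : Set V} {y₀ t s y₁ y₂ : V} (hy₀ : y₀ ∈ W) (hy₀X : y₀ ∉ X)
    (hX : ∀ v ∈ X, ¬G.Adj y₀ v) (ht : G.Adj y₀ t) (hs : G.Adj y₀ s)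
    (hy₁X : y₁ ∈ X) (hty₁ : G.Adj t y₁) (hsy₂ : G.Adj s y₂)
    (hreach : (edgesWithin G X).Reachable y₁ y₂) :
    ∃ y, (edgesWithin G X).Reachable y₁ y ∧ G.Adj t y ∧ G.Adj s y := by
  classical
  set H := edgesWithin G X with hH
  by_contra! hno
  have hex : ∃ n, ∃ a b, ∃ p : H.Walk a b, p.length = n ∧ H.Reachable y₁ a ∧ G.Adj t a ∧
      G.Adj s b := by
    obtain ⟨p⟩ := hreach
    exact ⟨_, y₁, y₂, p, rfl, .rfl, hty₁, hsy₂⟩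
  obtain ⟨a, b, p, hpn, hya, hta, hsb⟩ := Nat.find_spec hex
  have hmin : ∀ a' b' (q : H.Walk a' b'), H.Reachable y₁ a' → G.Adj t a' → G.Adj s b' →
      p.length ≤ q.length := fun a' b' q h₁ h₂ h₃ => by
    rw [hpn]
    exact Nat.find_min' hex ⟨a', b', q, rfl, h₁, h₂, h₃⟩
  clear hpn
  wlog hp : p.IsPath generalizing p
  · exact this p.bypass
      (fun a' b' q h₁ h₂ h₃ => p.length_bypass_le_length.trans (hmin a' b' q h₁ h₂ h₃))
      p.bypass_isPath
  have htU : t ∈ U := hb.symm.mem_right_of_adj hy₀ ht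
  have hsU : s ∈ U := hb.symm.mem_right_of_adj hy₀ hs
  have haW : a ∈ W := hb.mem_right_of_adj htU hta
  have hbW : b ∈ W := hb.mem_right_of_adj hsU hsb
  have hsuppreach : ∀ v ∈ p.support, H.Reachable y₁ v := fun v hv => hya.trans ⟨p.takeUntil v hv⟩
  have hsuppX : ∀ v ∈ p.support, v ∈ X := fun v hv =>
    mem_of_reachable_edgesWithin hy₁X (hsuppreach v hv)
  have htX : t ∉ X := fun h => hX t h ht
  have hsX : s ∉ X := fun h => hX s h hs
  have hts : t ≠ s := by
    rintro rfl
    exact hno a hya hta hta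
  have hty₀ : t ≠ y₀ := ht.ne'
  have hsy₀ : s ≠ y₀ := hs.ne'
  have hab : a ≠ b := by
    rintro rfl
    exact hno a hya hta hsb
  have hlen : 2 ≤ p.length := by
    have h0 : p.length ≠ 0 := fun h => hab (SimpleGraph.Walk.eq_of_length_eq_zero h)
    have h1 : p.length ≠ 1 := fun h =>
      hb.2.2.2 haW hbW (SimpleGraph.Walk.adj_of_length_eq_one h).1
    omega
  let q : G.Walk a b := p.mapLe (edgesWithin_le X)
  have hqs : q.support = p.support := SimpleGraph.Walk.support_mapLe_eq_support _ p
  have hqe : q.edges = p.edges := SimpleGraph.Walk.edges_mapLe_eq_edges _ p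
  have hql : q.length = p.length := by simp [q]
  have hq : q.IsPath := hp.mapLe _
  let r : G.Walk t y₀ := .cons hta ((q.concat hsb.symm).concat hs.symm)
  have hr : r.IsPath := by
    have h1 : s ∉ q.support := fun h => hsX (hsuppX s (hqs ▸ h))
    have h2 : y₀ ∉ q.support := fun h => hy₀X (hsuppX y₀ (hqs ▸ h))
    have h3 : t ∉ q.support := fun h => htX (hsuppX t (hqs ▸ h))
    rw [SimpleGraph.Walk.cons_isPath_iff]
    refine ⟨(hq.concat h1 _).concat ?_ _, ?_⟩
    · simp [SimpleGraph.Walk.support_concat, h2, hsy₀.symm]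
    · simp [SimpleGraph.Walk.support_concat, h3, hts, hty₀]
  let c : G.Walk y₀ y₀ := .cons ht r
  have hce : ∀ e, e ∈ c.edges ↔
      e = s(y₀, t) ∨ e = s(t, a) ∨ e ∈ p.edges ∨ e = s(b, s) ∨ e = s(s, y₀) := by
    intro e
    simp [c, r, SimpleGraph.Walk.edges_concat, hqe]
  have hcs : ∀ v, v ∈ c.support ↔ v = y₀ ∨ v = t ∨ v ∈ p.support ∨ v = s := by
    intro v
    simp [c, r, SimpleGraph.Walk.support_concat, hqs]
    tauto
  have hcyc : c.IsCycle := by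
    rw [SimpleGraph.Walk.cons_isCycle_iff]
    refine ⟨hr, ?_⟩
    have : s(y₀, t) ∉ p.edges := fun h => hy₀X (hsuppX y₀ (p.fst_mem_support_of_mem_edges h))
    have hay₀ : a ≠ y₀ := fun h => hy₀X (h ▸ hsuppX a p.start_mem_support)
    simp [r, SimpleGraph.Walk.edges_concat, hqe, this, hts, hty₀, hty₀.symm, hay₀.symm, hsy₀.symm]
  obtain ⟨u, w, huU, hwW, hu, hw, huw, hnot⟩ :=
    hc.exists_oriented_chord hb c hcyc (by simp [c, r, hql]; omega)
  rw [hcs] at hu hw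
  rw [hce] at hnot
  push Not at hnot
  obtain ⟨hn1, hn2, hn3, hn4, hn5⟩ := hnot
  have huy₀ : u ≠ y₀ := fun h => hb.notMem_right huU (h ▸ hy₀)
  have hwt : w ≠ t := fun h => hb.notMem_right (h ▸ htU) hwW
  have hws : w ≠ s := fun h => hb.notMem_right (h ▸ hsU) hwW
  rcases hw with rfl | hw | hw | hw
  · rcases hu with hu | rfl | hu | rfl
    · exact huy₀ hu
    · exact hn1 Sym2.eq_swap
    · exact hX u (hsuppX u hu) huw.symm
    · exact hn5 rfl
  · exact hwt hw
  · rcases hu with hu | rfl | hu | rfl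
    · exact huy₀ hu
    · have h1 := hmin w b (p.dropUntil w hw) (hsuppreach w hw) huw hsb
      have h2 := congrArg SimpleGraph.Walk.length (p.take_spec hw)
      rw [SimpleGraph.Walk.length_append] at h2
      have h3 : a = w := SimpleGraph.Walk.eq_of_length_eq_zero (p := p.takeUntil w hw) (by omega)
      exact hn2 (by rw [h3])
    · obtain ⟨p', hp'⟩ := p.exists_length_lt_of_chord hu hw
        ⟨huw, hsuppX u hu, hsuppX w hw⟩ hn3
      exact absurd (hmin a b p' hya hta hsb) (by omega)
    · have h1 := hmin a w (p.takeUntil w hw) hya hta huw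
      have h2 := congrArg SimpleGraph.Walk.length (p.take_spec hw)
      rw [SimpleGraph.Walk.length_append] at h2
      have h3 : w = b := SimpleGraph.Walk.eq_of_length_eq_zero (p := p.dropUntil w hw) (by omega)
      exact hn4 (by rw [h3, Sym2.eq_swap])
  · exact hws hw

/-- Conformality: a set in which any two vertices have a common neighbour in `C` is contained
in the neighbourhood of a single vertex of `C`. -/
theorem IsSixChordal.exists_dominating [Finite V] {U W : Set V} (hb : IsBipartition G U W)
    (hc : IsSixChordal G) {S C : Set V} (hS : S ⊆ U) (hC : C.Nonempty)
    (h : ∀ t ∈ S, ∀ s ∈ S, ∃ y ∈ C, G.Adj t y ∧ G.Adj s y) :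
    ∃ y ∈ C, ∀ s ∈ S, G.Adj s y := by
  obtain ⟨y, hyC, hy⟩ := Set.exists_max_image C (fun y => {s | s ∈ S ∧ G.Adj s y}.ncard)
    (Set.toFinite _) hC
  refine ⟨y, hyC, fun s hs => ?_⟩
  by_contra hsy
  obtain ⟨z, hzC, hsz, -⟩ := h s hs s hs
  obtain ⟨y', ⟨hy'C, hsy'⟩, hy'⟩ := Set.exists_max_image {y' | y' ∈ C ∧ G.Adj s y'}
    (fun y' => {r | r ∈ S ∧ G.Adj r y ∧ G.Adj r y'}.ncard) (Set.toFinite _) ⟨z, hzC, hsz⟩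
  obtain ⟨t, htS, hty, hty'⟩ : ∃ t ∈ S, G.Adj t y ∧ ¬G.Adj t y' := by
    by_contra! hcon
    refine absurd (hy y' hy'C) (not_le.mpr (Set.ncard_lt_ncard ?_ (Set.toFinite _)))
    exact ⟨fun r hr => ⟨hr.1, hcon r hr.1 hr.2⟩, fun hsub => hsy (hsub ⟨hs, hsy'⟩).2⟩
  obtain ⟨y'', hy''C, hty'', hsy''⟩ := h t htS s hs
  obtain ⟨r, hrS, hry, hry', hry''⟩ : ∃ r ∈ S, G.Adj r y ∧ G.Adj r y' ∧ ¬G.Adj r y'' := by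
    by_contra! hcon
    refine absurd (hy' y'' ⟨hy''C, hsy''⟩) (not_le.mpr (Set.ncard_lt_ncard ?_ (Set.toFinite _)))
    exact ⟨fun r hr => ⟨hr.1, hr.2.1, hcon r hr.1 hr.2.1 hr.2.2⟩,
      fun hsub => hty' (hsub ⟨htS, hty, hty''⟩).2.2⟩
  rcases hc.hexagon hb (hS htS) (hS hrS) (hS hs) hty hry hry' hsy' hsy'' hty'' with h | h | h
  · exact hty' h
  · exact hry'' h
  · exact hsy h

/-- In the subgraph induced by `A ∪ B`, a vertex of `B` that misses a non-isolated vertex of `A`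
also misses a vertex of `A` having a neighbour of largest neighbourhood. -/
theorem IsSixChordal.exists_maximum_neighbor [Finite V] {U W : Set V}
    (hb : IsBipartition G U W) (hc : IsSixChordal G) {A B : Set V} (hA : A ⊆ U) (hB : B ⊆ W)
    {y₀ a₀ : V} (hy₀ : y₀ ∈ B) (ha₀ : a₀ ∈ A) (hna : ¬G.Adj y₀ a₀) (hnb : ∃ y ∈ B, G.Adj a₀ y) :
    ∃ x ∈ A, ¬G.Adj y₀ x ∧ ∃ y ∈ B, G.Adj x y ∧
      ∀ y' ∈ B, G.Adj x y' → ∀ u ∈ A, G.Adj y' u → G.Adj y u := by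
  induction hn : B.ncard using Nat.strong_induction_on generalizing A B y₀ a₀ with
  | _ n ih =>
  subst hn
  let X : Set V := {v | (v ∈ A ∧ ¬G.Adj y₀ v) ∨ (v ∈ B ∧ v ≠ y₀)}
  let C : Set V := {w | w ∈ W ∧ (edgesWithin G X).Reachable a₀ w}
  let A' : Set V := {v | v ∈ A ∧ ∃ y ∈ C, G.Adj y v}
  have ha₀X : a₀ ∈ X := Or.inl ⟨ha₀, hna⟩
  have hCX : ∀ w ∈ C, w ∈ X := fun w hw => mem_of_reachable_edgesWithin ha₀X hw.2
  have hCB : ∀ w ∈ C, w ∈ B ∧ w ≠ y₀ := fun w hw =>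
    (hCX w hw).resolve_left fun h => hb.notMem_right (hA h.1) hw.1
  have hreach : ∀ v ∈ A', ¬G.Adj y₀ v → (edgesWithin G X).Reachable a₀ v := by
    rintro v ⟨hvA, y, hyC, hyv⟩ hv
    have hadj : (edgesWithin G X).Adj y v := ⟨hyv, hCX y hyC, Or.inl ⟨hvA, hv⟩⟩
    exact hyC.2.trans hadj.reachable
  have hnbr : ∀ v ∈ A, (edgesWithin G X).Reachable a₀ v → ∀ y ∈ B, G.Adj v y → y ∈ C := by
    intro v hvA hv y hy hvy
    have hvX := mem_of_reachable_edgesWithin ha₀X hv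
    have hvy₀ : ¬G.Adj y₀ v :=
      (hvX.resolve_right fun h => hb.notMem_right (hA hvA) (hB h.1)).2
    have hyy₀ : y ≠ y₀ := by
      rintro rfl
      exact hvy₀ hvy.symm
    have hadj : (edgesWithin G X).Adj v y := ⟨hvy, hvX, Or.inr ⟨hy, hyy₀⟩⟩
    exact ⟨hB hy, hv.trans hadj.reachable⟩
  obtain ⟨z, hzB, haz⟩ := hnb
  have hzC : z ∈ C := hnbr a₀ ha₀ .rfl z hzB haz
  obtain ⟨y, hyC, hy⟩ : ∃ y ∈ C, ∀ s ∈ {s | s ∈ A' ∧ G.Adj y₀ s}, G.Adj s y := by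
    refine hc.exists_dominating hb (fun s hs => hA hs.1.1) ⟨z, hzC⟩ ?_
    rintro t ⟨⟨htA, y₁, hy₁, hy₁t⟩, ht⟩ s ⟨⟨hsA, y₂, hy₂, hy₂s⟩, hs⟩
    obtain ⟨y, hy, hty, hsy⟩ := hc.exists_common_neighbor hb (X := X) (hB hy₀)
      (by rintro (h | h)
          · exact hb.notMem_right (hA h.1) (hB hy₀)
          · exact h.2 rfl)
      (by rintro v (h | h)
          · exact h.2
          · exact hb.2.2.2 (hB hy₀) (hB h.1))
      ht hs (hCX y₁ hy₁) hy₁t.symm hy₂s.symm (hy₁.2.symm.trans hy₂.2)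
    exact ⟨y, ⟨hb.mem_right_of_adj (hA htA) hty, hy₁.2.trans hy⟩, hty, hsy⟩
  by_cases hall : ∀ v ∈ A', G.Adj y v
  · exact ⟨a₀, ha₀, hna, y, (hCB y hyC).1, (hall a₀ ⟨ha₀, z, hzC, haz.symm⟩).symm,
      fun y' hy' ha₀y' u hu hy'u => hall u ⟨hu, y', hnbr a₀ ha₀ .rfl y' hy' ha₀y', hy'u⟩⟩
  · push Not at hall
    obtain ⟨v, hvA', hyv⟩ := hall
    have hlt : C.ncard < B.ncard := Set.ncard_lt_ncard
      ⟨fun w hw => (hCB w hw).1, fun hsub => (hCB y₀ (hsub hy₀)).2 rfl⟩ (Set.toFinite _)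
    obtain ⟨x, hxA', hyx, y', hy'C, hxy', hmax⟩ := ih _ hlt (A := A') (B := C)
      (fun _ h => hA h.1) (fun _ h => h.1) hyC hvA' hyv
      (hvA'.2.imp fun _ h => ⟨h.1, h.2.symm⟩) rfl
    have hy₀x : ¬G.Adj y₀ x := fun h => hyx (hy x ⟨hxA', h⟩).symm
    refine ⟨x, hxA'.1, hy₀x, y', (hCB y' hy'C).1, hxy', fun w hw hxw u hu hwu => ?_⟩
    have hwC := hnbr x hxA'.1 (hreach x hxA' hy₀x) w hw hxw
    exact hmax w hwC hxw u ⟨hu, w, hwC, hwu⟩ hwu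

theorem IsSixChordal.exists_rare [Finite V] {U W : Set V} (hb : IsBipartition G U W)
    (hc : IsSixChordal G) {a b : V} (ha : a ∈ U) (hab : G.Adj a b) : ∃ w ∈ W, Rare G w := by
  by_cases h : ∃ y₀ ∈ W, ∃ a₀ ∈ U, ¬G.Adj y₀ a₀ ∧ ∃ y ∈ W, G.Adj a₀ y
  · obtain ⟨y₀, hy₀, a₀, ha₀, hna, hnb⟩ := h
    obtain ⟨x, hx, -, y, hy, hxy, hmax⟩ :=
      hc.exists_maximum_neighbor hb subset_rfl subset_rfl hy₀ ha₀ hna hnb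
    refine ⟨y, hy, rare_of_maximum_neighbor hb hx hxy fun y' hxy' u hy'u => ?_⟩
    have hy' := hb.mem_right_of_adj hx hxy'
    exact hmax y' hy' hxy' u (hb.symm.mem_right_of_adj hy' hy'u) hy'u
  · push Not at h
    have hbW := hb.mem_right_of_adj ha hab
    refine ⟨b, hbW, rare_of_maximum_neighbor hb ha hab fun y' hay' u hy'u => ?_⟩
    by_contra hbu
    have hy' := hb.mem_right_of_adj ha hay'
    exact h b hbW u (hb.symm.mem_right_of_adj hy' hy'u) hbu y' hy' hy'u.symm

end

/-- Chordal bipartite graphs satisfy Frankl's conjecture: if every cycle of length at least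
six has a chord, and the graph is bipartite with at least one edge, then each bipartition
class contains a rare vertex. -/
theorem chordal_bipartite_frankl {V : Type} [Fintype V] (G : SimpleGraph V) (U W : Set V)
    (hb : IsBipartition G U W) (he : G.edgeSet.Nonempty)
    (hchordal : ∀ (v : V) (c : G.Walk v v), c.IsCycle → 6 ≤ c.length →
      ∃ u w, u ∈ c.support ∧ w ∈ c.support ∧ G.Adj u w ∧ s(u, w) ∉ c.edges) :
    (∃ u ∈ U, Rare G u) ∧ (∃ w ∈ W, Rare G w) := by
  have hc : IsSixChordal G := hchordal
  obtain ⟨e, he⟩ := he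
  induction e with
  | _ a b =>
  rw [SimpleGraph.mem_edgeSet] at he
  rcases hb.mem_left_or_right a with ha | ha
  · exact ⟨hc.exists_rare hb.symm (hb.mem_right_of_adj ha he) he.symm, hc.exists_rare hb ha he⟩
  · exact ⟨hc.exists_rare hb.symm ha he,
      hc.exists_rare hb (hb.symm.mem_right_of_adj ha he) he.symm⟩
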